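/- Let G be a finite simple graph and let S be a maximum critical independent set of G. Then 2α'(G) = d(ker(G)) + |N[S]|. -/

import Mathlib

/-- `S` is an independent set in `G`: no two of its vertices are adjacent. -/
def IndepSet {V : Type*} (G : SimpleGraph V) (S : Set V) : Prop :=
  ∀ ⦃u⦄, u ∈ S → ∀ ⦃v⦄, v ∈ S → ¬G.Adj u v

/-- The independence number `α(G)`. -/
noncomputable def indNum {V : Type*} (G : SimpleGraph V) : ℕ :=
  sSup {n : ℕ | ∃ S : Set V, IndepSet G S ∧ S.ncard = n}

/-- `Ω(G)`: the family of maximum independent sets of `G`. -/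
def maxIndepFam {V : Type*} (G : SimpleGraph V) : Set (Set V) :=
  {S | IndepSet G S ∧ S.ncard = indNum G}

/-- `N(X)`: the neighborhood of a set of vertices. -/
def nbhd {V : Type*} (G : SimpleGraph V) (X : Set V) : Set V :=
  {v | ∃ x ∈ X, G.Adj v x}

/-- `N[X] = N(X) ∪ X`: the closed neighborhood of a set of vertices. -/
def closedNbhd {V : Type*} (G : SimpleGraph V) (X : Set V) : Set V :=
  nbhd G X ∪ X

/-- The difference `d(X) = |X| - |N(X)|`. -/
noncomputable def diffd {V : Type*} (G : SimpleGraph V) (X : Set V) : ℤ :=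
  (X.ncard : ℤ) - ((nbhd G X).ncard : ℤ)

/-- The critical difference `d(G) = max {d(X) : X ⊆ V(G)}`. -/
noncomputable def critDiff {V : Type*} (G : SimpleGraph V) : ℤ :=
  sSup {d : ℤ | ∃ X : Set V, diffd G X = d}

/-- `X` is a critical set if `d(X) = d(G)`. -/
def IsCritical {V : Type*} (G : SimpleGraph V) (X : Set V) : Prop :=
  diffd G X = critDiff G

/-- `MaxCritIndep(G)`: the family of critical independent sets of maximum cardinality. -/
def maxCritIndepFam {V : Type*} (G : SimpleGraph V) : Set (Set V) :=
  {S | IndepSet G S ∧ IsCritical G S ∧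
    ∀ T : Set V, IndepSet G T → IsCritical G T → T.ncard ≤ S.ncard}

/-- The critical independence number `α'(G)`. -/
noncomputable def critIndNum {V : Type*} (G : SimpleGraph V) : ℕ :=
  sSup {n : ℕ | ∃ S : Set V, IndepSet G S ∧ IsCritical G S ∧ S.ncard = n}

/-- `ker(G)`: the intersection of all critical independent sets. -/
def kerSet {V : Type*} (G : SimpleGraph V) : Set V :=
  ⋂₀ {A : Set V | IndepSet G A ∧ IsCritical G A}

/-- `nucleus(G)`: the intersection of all maximum critical independent sets. -/
def nucleus {V : Type*} (G : SimpleGraph V) : Set V :=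
  ⋂₀ maxCritIndepFam G

/-- `diadem(G)`: the union of all maximum critical independent sets. -/
def diadem {V : Type*} (G : SimpleGraph V) : Set V :=
  ⋃₀ maxCritIndepFam G

/-- `core(G)`: the intersection of all maximum independent sets. -/
def coreSet {V : Type*} (G : SimpleGraph V) : Set V :=
  ⋂₀ maxIndepFam G

/-- `corona(G)`: the union of all maximum independent sets. -/
def coronaSet {V : Type*} (G : SimpleGraph V) : Set V :=
  ⋃₀ maxIndepFam G

/-- A matching in `G`: a set of pairwise non-incident edges of `G`. -/
def IsMatchingSet {V : Type*} (G : SimpleGraph V) (M : Set (Sym2 V)) : Prop :=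
  M ⊆ G.edgeSet ∧ M.Pairwise fun e f => ∀ v, v ∈ e → v ∉ f

/-- The matching number `μ(G)`. -/
noncomputable def matchNum {V : Type*} (G : SimpleGraph V) : ℕ :=
  sSup {n : ℕ | ∃ M : Set (Sym2 V), IsMatchingSet G M ∧ M.ncard = n}

/-- `G` is a König-Egerváry graph if `α(G) + μ(G) = |V(G)|`. -/
def IsKonigEgervary {V : Type*} (G : SimpleGraph V) : Prop :=
  indNum G + matchNum G = Nat.card V

/-- `Γ` is a König-Egerváry collection: a family of independent sets with
`|⋂Γ| + |⋃Γ| = 2α(G)`. -/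
def IsKECollection {V : Type*} (G : SimpleGraph V) (Γ : Set (Set V)) : Prop :=
  (∀ S ∈ Γ, IndepSet G S) ∧ (⋂₀ Γ).ncard + (⋃₀ Γ).ncard = 2 * indNum G

theorem IndepSet.mono {V : Type*} {G : SimpleGraph V} {A B : Set V} (hB : IndepSet G B)
    (h : A ⊆ B) : IndepSet G A :=
  fun _ hu _ hv => hB (h hu) (h hv)

theorem nbhd_union {V : Type*} (G : SimpleGraph V) (A B : Set V) :
    nbhd G (A ∪ B) = nbhd G A ∪ nbhd G B := by
  ext v
  simp only [nbhd, Set.mem_union, Set.mem_ofPred_eq]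
  grind

theorem nbhd_mono {V : Type*} (G : SimpleGraph V) {A B : Set V} (h : A ⊆ B) :
    nbhd G A ⊆ nbhd G B :=
  fun _ ⟨x, hx, hv⟩ => ⟨x, h hx, hv⟩

theorem IndepSet.disjoint_nbhd {V : Type*} {G : SimpleGraph V} {S : Set V}
    (hS : IndepSet G S) : Disjoint (nbhd G S) S :=
  Set.disjoint_left.2 fun _ ⟨_, hx, hv⟩ hvS => hS hvS hx hv

theorem diffd_le_critDiff {V : Type*} [Finite V] (G : SimpleGraph V) (X : Set V) :
    diffd G X ≤ critDiff G :=
  le_csSup (Set.finite_range (diffd G)).bddAbove ⟨X, rfl⟩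

/-- The difference function is supermodular. -/
theorem diffd_add_le {V : Type*} [Finite V] (G : SimpleGraph V) (A B : Set V) :
    diffd G A + diffd G B ≤ diffd G (A ∪ B) + diffd G (A ∩ B) := by
  have hcard := Set.ncard_union_add_ncard_inter A B
  have hnbhd := Set.ncard_union_add_ncard_inter (nbhd G A) (nbhd G B)
  have hinter : (nbhd G (A ∩ B)).ncard ≤ (nbhd G A ∩ nbhd G B).ncard :=
    Set.ncard_le_ncard (Set.subset_inter (nbhd_mono G Set.inter_subset_left)
      (nbhd_mono G Set.inter_subset_right))
  simp only [diffd, nbhd_union]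
  omega

theorem IsCritical.inter {V : Type*} [Finite V] {G : SimpleGraph V} {A B : Set V}
    (hA : IsCritical G A) (hB : IsCritical G B) : IsCritical G (A ∩ B) := by
  have hadd := diffd_add_le G A B
  have hunion := diffd_le_critDiff G (A ∪ B)
  have hinter := diffd_le_critDiff G (A ∩ B)
  unfold IsCritical at *
  omega

/-- `ker(G)` is critical as soon as there is a critical independent set. -/
theorem isCritical_kerSet {V : Type*} [Finite V] {G : SimpleGraph V} {S : Set V}
    (hS : IndepSet G S) (hcrit : IsCritical G S) : IsCritical G (kerSet G) := by
  obtain ⟨A, hA⟩ := (Set.toFinite {A : Set V | IndepSet G A ∧ IsCritical G A}).exists_minimal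
    ⟨S, hS, hcrit⟩
  have hker : kerSet G = A := by
    refine (Set.sInter_subset_of_mem hA.prop).antisymm (Set.subset_sInter fun B hB => ?_)
    have hAB : A ∩ B ∈ {A : Set V | IndepSet G A ∧ IsCritical G A} :=
      ⟨hA.prop.1.mono Set.inter_subset_left, hA.prop.2.inter hB.2⟩
    exact (hA.le_of_le hAB Set.inter_subset_left).trans Set.inter_subset_right
  exact hker ▸ hA.prop.2

theorem critIndNum_eq_ncard {V : Type*} {G : SimpleGraph V} {S : Set V}
    (hS : S ∈ maxCritIndepFam G) : critIndNum G = S.ncard := by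
  refine IsGreatest.csSup_eq ⟨⟨S, hS.1, hS.2.1, rfl⟩, ?_⟩
  rintro n ⟨T, hT, hcrit, rfl⟩
  exact hS.2.2 T hT hcrit

/-- If `S` is a maximum critical independent set of `G`, then
`2α'(G) = d(ker(G)) + |N[S]|`. -/
theorem stmt12 {V : Type*} [Fintype V] (G : SimpleGraph V)
    (S : Set V) (hS : S ∈ maxCritIndepFam G) :
    (2 * critIndNum G : ℤ) = diffd G (kerSet G) + ((closedNbhd G S).ncard : ℤ) := by
  have hker : diffd G (kerSet G) = critDiff G := isCritical_kerSet hS.1 hS.2.1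
  have hdiff : diffd G S = critDiff G := hS.2.1
  rw [critIndNum_eq_ncard hS, hker, ← hdiff, closedNbhd,
    Set.ncard_union_eq hS.1.disjoint_nbhd, diffd]
  push_cast
  ring
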